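/- Let f and f_n (n ∈ ℕ) be nonincreasing functions from [0,∞) to ℝ such that f is continuous, f(0) ≥ 0, and f is unbounded below (for every M > 0 there exists t with f(t) ≤ −M). Assume f_n(t) → f(t) as n → ∞ for every t ≥ 0. Fix x > 0 such that the map y ↦ S_f(y) is right-continuous at x, i.e. S_f(y) → S_f(x) as y ↓ x. Then for every sequence of positive reals x_n → x one has S_{f_n}(x_n) → S_f(x). -/

import Mathlib

open Filter Set

/-- First-passage time of `g` below level `-x`, over nonnegative times. -/
noncomputable def firstPassage (g : ℝ → ℝ) (x : ℝ) : ℝ :=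
  sInf {t : ℝ | 0 ≤ t ∧ g t ≤ -x}

theorem firstPassage_nonneg (g : ℝ → ℝ) (x : ℝ) : 0 ≤ firstPassage g x :=
  Real.sInf_nonneg fun _ ht => ht.1

theorem firstPassage_le {g : ℝ → ℝ} {x t : ℝ} (ht : 0 ≤ t) (hg : g t ≤ -x) :
    firstPassage g x ≤ t :=
  csInf_le ⟨0, fun _ hs => hs.1⟩ ⟨ht, hg⟩

theorem le_firstPassage {g : ℝ → ℝ} {x b : ℝ} (hg : AntitoneOn g (Ici 0)) (hb : 0 ≤ b)
    (hgb : -x < g b) (hne : ∃ t, 0 ≤ t ∧ g t ≤ -x) : b ≤ firstPassage g x := by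
  refine le_csInf hne fun t ht => le_of_not_gt fun htb => ?_
  exact (hgb.trans_le (hg ht.1 hb htb.le)).not_ge ht.2

/-- Continuity of first-passage times for nonincreasing functions.
If `f` is nonincreasing and continuous on `[0,∞)`, `f 0 ≥ 0`, `f` is unbounded
below, the `f n` are nonincreasing and converge pointwise to `f` on `[0,∞)`,
`x > 0` is a point at which `y ↦ S_f(y)` is right-continuous, and `xₙ → x` is a
sequence of positive reals, then `S_{fₙ}(xₙ) → S_f(x)`. -/
theorem firstPassage_tendsto_of_pointwise_conv
    (f : ℝ → ℝ) (fseq : ℕ → ℝ → ℝ)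
    (hf_anti : AntitoneOn f (Ici (0 : ℝ)))
    (hfn_anti : ∀ n, AntitoneOn (fseq n) (Ici (0 : ℝ)))
    (hf_cont : ContinuousOn f (Ici (0 : ℝ)))
    (hf0 : 0 ≤ f 0)
    (hf_unbdd : ∀ M : ℝ, 0 < M → ∃ t : ℝ, 0 ≤ t ∧ f t ≤ -M)
    (hconv : ∀ t : ℝ, 0 ≤ t → Tendsto (fun n => fseq n t) atTop (nhds (f t)))
    (x : ℝ) (hx : 0 < x)
    (hrc : Tendsto (fun y => firstPassage f y) (nhdsWithin x (Ioi x))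
      (nhds (firstPassage f x)))
    (xseq : ℕ → ℝ) (hxpos : ∀ n, 0 < xseq n)
    (hxconv : Tendsto xseq atTop (nhds x)) :
    Tendsto (fun n => firstPassage (fseq n) (xseq n)) atTop
      (nhds (firstPassage f x)) := by
  have hreach : ∀ c, firstPassage f x < c →
      ∃ t, 0 ≤ t ∧ t < c ∧ ∀ᶠ n in atTop, fseq n t ≤ -xseq n := by
    intro c hc
    obtain ⟨y, hyc, hxy⟩ := ((hrc.eventually_lt_const hc).and self_mem_nhdsWithin).exists
    have hxy : x < y := hxy
    obtain ⟨t, ⟨ht0, hty⟩, htc⟩ := exists_lt_of_csInf_lt (hf_unbdd y (hx.trans hxy)) hyc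
    have hlt : f t < -x := by linarith
    exact ⟨t, ht0, htc, ((hconv t ht0).eventually_lt hxconv.neg hlt).mono fun _ h => h.le⟩
  refine tendsto_order.2 ⟨fun a ha => ?_, fun c hc => ?_⟩
  · rcases lt_or_ge a 0 with ha0 | ha0
    · exact Eventually.of_forall fun n => ha0.trans_le (firstPassage_nonneg _ _)
    · obtain ⟨b, hab, hbS⟩ := exists_between ha
      have hb : 0 ≤ b := ha0.trans hab.le
      have hfb : -x < f b := lt_of_not_ge fun h => hbS.not_ge (firstPassage_le hb h)
      obtain ⟨t, ht0, -, ht⟩ := hreach (firstPassage f x + 1) (lt_add_one _)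
      filter_upwards [ht, hxconv.neg.eventually_lt (hconv b hb) hfb] with n hnt hnb
      exact hab.trans_le (le_firstPassage (hfn_anti n) hb hnb ⟨t, ht0, hnt⟩)
  · obtain ⟨t, ht0, htc, ht⟩ := hreach c hc
    exact ht.mono fun n hn => (firstPassage_le ht0 hn).trans_lt htc
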